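/- arXiv:1502.04332 — 2 statements merged into one kernel-verified Lean document; each statement's English description precedes it below -/
import Mathlib

section
/- Let n ≥ 4 be an integer, p a prime, and C₀ = [c_{i,j}] a matrix in R₀^(n)(p). Then: (a) C₀ ≠ p·I_n; (b) for all indices 1 ≤ i < k < j < ℓ ≤ n, c_{i,j}·c_{k,ℓ} ≡ c_{i,ℓ}·c_{k,j} (mod p); and (c) for all indices 1 ≤ i < j ≤ k < ℓ ≤ n, c_{i,j}·c_{k,ℓ} = 0. -/
open Matrix

/-- `Λ_n = GL_n(ℤ)` viewed inside the `n × n` rational matrices: the matrices with integer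
entries whose determinant is `±1`. -/
def Lambda (n : ℕ) : Set (Matrix (Fin n) (Fin n) ℚ) :=
  {γ | (∀ i j, ∃ z : ℤ, γ i j = (z : ℚ)) ∧ (γ.det = 1 ∨ γ.det = -1)}

/-- The right coset `Λ_n h = {γ * h : γ ∈ Λ_n}`. -/
def rightCoset (n : ℕ) (h : Matrix (Fin n) (Fin n) ℚ) : Set (Matrix (Fin n) (Fin n) ℚ) :=
  {m | ∃ γ ∈ Lambda n, m = γ * h}

/-- The double coset `Λ_n g Λ_n = {γ₁ * g * γ₂ : γ₁, γ₂ ∈ Λ_n}`. -/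
def doubleCoset (n : ℕ) (g : Matrix (Fin n) (Fin n) ℚ) : Set (Matrix (Fin n) (Fin n) ℚ) :=
  {m | ∃ γ₁ ∈ Lambda n, ∃ γ₂ ∈ Lambda n, m = γ₁ * g * γ₂}

/-- The degree of `g`: the number of distinct right cosets `Λ_n h` contained in `Λ_n g Λ_n`. -/
noncomputable def degree (n : ℕ) (g : Matrix (Fin n) (Fin n) ℚ) : ℕ :=
  Set.ncard {S : Set (Matrix (Fin n) (Fin n) ℚ) | ∃ h ∈ doubleCoset n g, S = rightCoset n h}

/-- The `k`-th determinantal divisor of an `n × n` integer matrix: the gcd of all of its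
`k × k` minors (which is `0` when all these minors vanish), a minor being indexed by a pair
of strictly increasing maps `Fin k → Fin n` selecting rows and columns. -/
def detDiv (n k : ℕ) (C : Matrix (Fin n) (Fin n) ℤ) : ℤ :=
  Finset.gcd ((Finset.univ : Finset ((Fin k → Fin n) × (Fin k → Fin n))).filter
      (fun fg => (∀ a b : Fin k, a < b → fg.1 a < fg.1 b) ∧
        (∀ a b : Fin k, a < b → fg.2 a < fg.2 b)))
    (fun fg => (C.submatrix fg.1 fg.2).det)

/-- `D^(n)(p) = diag(1, p, …, p, p²)` with `n - 2` middle diagonal entries equal to `p`. -/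
def Dmat (n p : ℕ) : Matrix (Fin n) (Fin n) ℤ :=
  Matrix.diagonal (fun i => if i.val = 0 then 1 else if i.val = n - 1 then (p : ℤ) ^ 2 else (p : ℤ))

/-- The set `R₀^(n)(p)` of upper-triangular integer matrices whose determinantal divisors are
`d_k = p^(k-1)` for `1 ≤ k ≤ n - 1` and `d_n = p^n`, whose diagonal entries all equal `p`, and
whose above-diagonal entries lie in `[0, p)`. -/
def R0 (n p : ℕ) : Set (Matrix (Fin n) (Fin n) ℤ) :=
  {C | (∀ i j : Fin n, j < i → C i j = 0) ∧
    (∀ k : ℕ, 1 ≤ k → k ≤ n - 1 → detDiv n k C = (p : ℤ) ^ (k - 1)) ∧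
    detDiv n n C = (p : ℤ) ^ n ∧
    (∀ i : Fin n, C i i = (p : ℤ)) ∧
    (∀ i j : Fin n, i < j → 0 ≤ C i j ∧ C i j < (p : ℤ))}

/-- The set `R₁^(n)(p)` of upper-triangular integer matrices whose diagonal entries lie in
`{1, p, p²}` with exactly one entry `1` and exactly one entry `p²`, whose above-diagonal
entries satisfy `0 ≤ c i j < c j j`, and such that `p ∣ c i i` implies `p ∣ c i j` for `j > i`. -/
def R1 (n p : ℕ) : Set (Matrix (Fin n) (Fin n) ℤ) :=
  {C | (∀ i j : Fin n, j < i → C i j = 0) ∧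
    (∀ i : Fin n, C i i = 1 ∨ C i i = (p : ℤ) ∨ C i i = (p : ℤ) ^ 2) ∧
    (∃! i : Fin n, C i i = 1) ∧
    (∃! i : Fin n, C i i = (p : ℤ) ^ 2) ∧
    (∀ i j : Fin n, i < j → 0 ≤ C i j ∧ C i j < C j j) ∧
    (∀ i j : Fin n, i < j → (p : ℤ) ∣ C i i → (p : ℤ) ∣ C i j)}

/-- Casting an integer matrix to a rational matrix. -/
def toQ (n : ℕ) (C : Matrix (Fin n) (Fin n) ℤ) : Matrix (Fin n) (Fin n) ℚ :=
  C.map (fun z : ℤ => (z : ℚ))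

/-- The `k`-th determinantal divisor divides every `k × k` minor. -/
theorem detDiv_dvd_det_submatrix {n k : ℕ} (C : Matrix (Fin n) (Fin n) ℤ)
    {f g : Fin k → Fin n} (hf : StrictMono f) (hg : StrictMono g) :
    detDiv n k C ∣ (C.submatrix f g).det := by
  unfold detDiv
  exact Finset.gcd_dvd (f := fun fg : (Fin k → Fin n) × (Fin k → Fin n) =>
    (C.submatrix fg.1 fg.2).det) (b := (f, g))
    (Finset.mem_filter.2 ⟨Finset.mem_univ _, fun _ _ h => hf h, fun _ _ h => hg h⟩)

/-- The second determinantal divisor divides every `2 × 2` minor, written out explicitly. -/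
theorem detDiv_two_dvd {n : ℕ} (C : Matrix (Fin n) (Fin n) ℤ) {i k j l : Fin n}
    (hik : i < k) (hjl : j < l) : detDiv n 2 C ∣ C i j * C k l - C i l * C k j := by
  have h := detDiv_dvd_det_submatrix C (f := ![i, k]) (g := ![j, l])
    (by simpa [Fin.strictMono_iff_lt_succ] using hik)
    (by simpa [Fin.strictMono_iff_lt_succ] using hjl)
  rw [Matrix.det_fin_two] at h
  exact h

/-- A common divisor of all entries divides the first determinantal divisor. -/
theorem dvd_detDiv_one {n : ℕ} {C : Matrix (Fin n) (Fin n) ℤ} {a : ℤ}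
    (h : ∀ i j, a ∣ C i j) : a ∣ detDiv n 1 C := by
  unfold detDiv
  refine Finset.dvd_gcd fun fg _ => ?_
  simpa using h _ _

theorem statement12 (n p : ℕ) (hn : 4 ≤ n) (hp : p.Prime)
    (C : Matrix (Fin n) (Fin n) ℤ) (hC : C ∈ R0 n p) :
    C ≠ (p : ℤ) • (1 : Matrix (Fin n) (Fin n) ℤ) ∧
    (∀ i k j l : Fin n, i < k → k < j → j < l →
      Int.ModEq (p : ℤ) (C i j * C k l) (C i l * C k j)) ∧
    (∀ i j k l : Fin n, i < j → j ≤ k → k < l → C i j * C k l = 0) := by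
  obtain ⟨hlower, hdiv, -, hdiag, hentry⟩ := hC
  have h1 : detDiv n 1 C = 1 := by simpa using hdiv 1 le_rfl (by omega)
  have h2 : detDiv n 2 C = p := by simpa using hdiv 2 (by omega) (by omega)
  have hp' : Prime (p : ℤ) := Nat.prime_iff_prime_int.mp hp
  have hminor : ∀ {i k j l : Fin n}, i < k → j < l →
      (p : ℤ) ∣ C i j * C k l - C i l * C k j := fun hik hjl =>
    h2 ▸ detDiv_two_dvd C hik hjl
  have hzero : ∀ {i j : Fin n}, i < j → (p : ℤ) ∣ C i j → C i j = 0 := fun hij h =>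
    Int.eq_zero_of_dvd_of_nonneg_of_lt (hentry _ _ hij).1 (hentry _ _ hij).2 h
  refine ⟨?_, ?_, ?_⟩
  · intro h
    have hdvd : (p : ℤ) ∣ detDiv n 1 C := dvd_detDiv_one fun i j => by
      rw [h, Matrix.smul_apply, smul_eq_mul]
      exact dvd_mul_right _ _
    exact hp'.not_dvd_one (h1 ▸ hdvd)
  · intro i k j l hik hkj hjl
    exact (Int.modEq_iff_dvd.2 (hminor hik hjl)).symm
  · intro i j k l hij hjk hkl
    have hkj : (p : ℤ) ∣ C k j := by
      rcases hjk.eq_or_lt with rfl | hlt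
      · rw [hdiag]
      · rw [hlower _ _ hlt]
        exact dvd_zero _
    have hdvd : (p : ℤ) ∣ C i j * C k l :=
      (dvd_sub_left (hkj.mul_left _)).1 (hminor (hij.trans_le hjk) (hjk.trans_lt hkl))
    rcases hp'.dvd_or_dvd hdvd with h | h
    · rw [hzero hij h, zero_mul]
    · rw [hzero hkl h, mul_zero]
end

section
/- Let n ≥ 4 be an integer and p a prime. The number of ordered pairs (C, C') with C, C' ∈ R^(n)(p) = R₀^(n)(p) ∪ R₁^(n)(p) such that the product C·C' belongs to the right coset Λ_n·(p²·I_n) equals p·(p^{n−1}−1)·(p^n−1)/(p−1)². -/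
open Matrix

/-- All `2 × 2` minors of `A` vanish modulo `p`. -/
def RankLEOneMod {l m : Type*} (p : ℤ) (A : Matrix l m ℤ) : Prop :=
  ∀ i i' j j', p ∣ A i j * A i' j' - A i j' * A i' j

namespace RankLEOneMod

variable {l m k : Type*} {p : ℤ}

theorem transpose {A : Matrix l m ℤ} (h : RankLEOneMod p A) : RankLEOneMod p Aᵀ := by
  intro i i' j j'
  have := h j j' i i'
  simp only [transpose_apply]
  rwa [mul_comm (A j' i)]

theorem submatrix {l' m' : Type*} {A : Matrix l m ℤ} (h : RankLEOneMod p A)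
    (f : l' → l) (g : m' → m) : RankLEOneMod p (A.submatrix f g) :=
  fun i i' j j' => h (f i) (f i') (g j) (g j')

theorem mul_left [Fintype m] {A : Matrix m k ℤ} (h : RankLEOneMod p A) (X : Matrix l m ℤ) :
    RankLEOneMod p (X * A) := by
  intro i i' j j'
  simp only [mul_apply, Finset.sum_mul_sum, ← Finset.sum_sub_distrib]
  refine Finset.dvd_sum fun a _ => Finset.dvd_sum fun b _ => ?_
  have := (h a b j j').mul_left (X i a * X i' b)
  convert this using 1
  ring

theorem mul_right [Fintype m] {A : Matrix l m ℤ} (h : RankLEOneMod p A) (X : Matrix m k ℤ) :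
    RankLEOneMod p (A * X) := by
  simpa using (h.transpose.mul_left Xᵀ).transpose

/-- A matrix of rank one modulo `p` can be row reduced so that all rows but one are divisible
by `p`. -/
theorem exists_row_reduction [Fintype l] [DecidableEq l] {A : Matrix l m ℤ} (hp : Prime p)
    (h : RankLEOneMod p A) {i₀ : l} {j₀ : m} (h₀ : ¬ p ∣ A i₀ j₀) :
    ∃ (U : Matrix l l ℤ) (A' : Matrix l m ℤ), U.det = 1 ∧
      U * A = diagonal (fun i => if i = i₀ then 1 else p) * A' := by
  obtain ⟨x, y, hxy⟩ := (hp.coprime_iff_not_dvd.2 h₀)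
  let w : l → ℤ := fun i => if i = i₀ then 0 else y * A i j₀
  have hw : ∀ i j, ∃ c, A i j - w i * A i₀ j = (if i = i₀ then 1 else p) * c := by
    intro i j
    by_cases hi : i = i₀
    · exact ⟨A i j, by simp [w, hi]⟩
    · obtain ⟨c, hc⟩ := h i i₀ j j₀
      refine ⟨A i j * x + y * c, ?_⟩
      simp only [w, hi, if_false]
      linear_combination (-A i j) * hxy + y * hc
  choose A' hA' using hw
  let U : Matrix l l ℤ := of fun i j => (1 : Matrix l l ℤ) i j - w i * (1 : Matrix l l ℤ) i₀ j
  refine ⟨U, of A', ?_, ?_⟩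
  · rw [← det_one (R := ℤ) (n := l)]
    refine det_eq_of_forall_row_eq_smul_add_const (-w) i₀ (by simp [w]) fun i j => ?_
    simp only [U, of_apply, Pi.neg_apply]
    ring
  · ext i j
    rw [diagonal_mul, of_apply, ← hA', mul_apply]
    simp only [U, of_apply, sub_mul, Finset.sum_sub_distrib, mul_assoc, ← Finset.mul_sum]
    simp [← mul_apply]

theorem prod_ite_one_const [Fintype l] [DecidableEq l] (i₀ : l) :
    ∏ i, (if i = i₀ then 1 else p) = p ^ (Fintype.card l - 1) := by
  rw [← Finset.mul_prod_erase _ _ (Finset.mem_univ i₀), if_pos rfl, one_mul,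
    Finset.prod_congr rfl fun i hi => if_neg (Finset.ne_of_mem_erase hi), Finset.prod_const,
    Finset.card_erase_of_mem (Finset.mem_univ _), Finset.card_univ]

theorem pow_dvd_det [Fintype l] [DecidableEq l] {A : Matrix l l ℤ} (hp : Prime p)
    (h : RankLEOneMod p A) : p ^ (Fintype.card l - 1) ∣ A.det := by
  by_cases h₀ : ∀ i j, p ∣ A i j
  · choose A' hA' using h₀
    have : A = p • of A' := by ext i j; simp [hA']
    rw [this, det_smul]
    exact (pow_dvd_pow _ (Nat.sub_le _ _)).mul_right _
  · push Not at h₀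
    obtain ⟨i₀, j₀, h₀⟩ := h₀
    obtain ⟨U, A', hU, hA⟩ := h.exists_row_reduction hp h₀
    have := congrArg det hA
    rw [det_mul, det_mul, hU, one_mul, det_diagonal, prod_ite_one_const] at this
    exact this ▸ dvd_mul_right _ _

/-- If `A * X = d` with `d = det A ≠ 0`, then the `2 × 2` minors of `X` vanish modulo `d`. -/
theorem of_mul_eq_det [Fintype l] [DecidableEq l] {A X : Matrix l l ℤ} (hA : A.det = p)
    (hp : p ≠ 0) (hAX : A * X = p • (1 : Matrix l l ℤ)) : RankLEOneMod p X := by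
  intro k k' j j'
  by_cases hk : k = k'
  · simp [hk, mul_comm]
  let V : Matrix l (Fin 2) ℤ := of fun i t =>
    ![X i j - (1 : Matrix l l ℤ) i k, X i j' - (1 : Matrix l l ℤ) i k'] t
  let W : Matrix (Fin 2) l ℤ := of fun t i =>
    ![(1 : Matrix l l ℤ) k i, (1 : Matrix l l ℤ) k' i] t
  have hdet : (1 + V * W).det = X k j * X k' j' - X k j' * X k' j := by
    rw [det_one_add_mul_comm, det_fin_two]
    simp [V, W, mul_apply, one_apply, hk, Ne.symm hk]
  have hmul : A * (1 + V * W) =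
      (A.updateCol k (p • Pi.single j 1)).updateCol k' (p • Pi.single j' 1) := by
    have hcol : ∀ i c, ∑ x, A i x * X x c = p * (1 : Matrix l l ℤ) i c := fun i c => by
      simpa [mul_apply] using congrFun (congrFun hAX i) c
    ext i c
    simp only [mul_add, mul_one, Matrix.add_apply, ← Matrix.mul_assoc]
    have hV : ∀ t, (A * V) i t = ![p * (1 : Matrix l l ℤ) i j - A i k,
        p * (1 : Matrix l l ℤ) i j' - A i k'] t := by
      intro t
      fin_cases t <;>
        simp [V, mul_apply, mul_sub, Finset.sum_sub_distrib, hcol, one_apply]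
    rw [mul_apply, Fin.sum_univ_two, hV, hV]
    by_cases h1 : c = k'
    · subst h1
      simp [W, one_apply, hk, Pi.single_apply]
    · by_cases h2 : c = k
      · subst h2
        simp [W, one_apply, h1, Ne.symm h1, Pi.single_apply]
      · simp [W, one_apply, h1, h2, Ne.symm h1, Ne.symm h2]
  have := congrArg det hmul
  rw [det_mul, hdet, det_updateCol_smul, updateCol_comm _ hk, det_updateCol_smul, hA] at this
  exact ⟨_, mul_left_cancel₀ hp this⟩

/-- A matrix of rank one modulo `p` and of determinant `p ^ n` has an integral inverse up to `p²`,
which is again of rank at most one modulo `p`. -/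
theorem exists_mul_eq_sq [Fintype l] [DecidableEq l] {A : Matrix l l ℤ} (hp : Prime p)
    (h : RankLEOneMod p A) {i₀ j₀ : l} (h₀ : ¬ p ∣ A i₀ j₀) (hA : A.det = p ^ Fintype.card l) :
    ∃ B : Matrix l l ℤ, B * A = p ^ 2 • (1 : Matrix l l ℤ) ∧ RankLEOneMod p B := by
  obtain ⟨U, A', hU, hUA⟩ := h.exists_row_reduction hp h₀
  have hdet : A'.det = p := by
    have := congrArg det hUA
    rw [det_mul, det_mul, hU, one_mul, det_diagonal, prod_ite_one_const, hA] at this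
    have hc : Fintype.card l = Fintype.card l - 1 + 1 :=
      (Nat.sub_add_cancel (Fintype.card_pos_iff.2 ⟨i₀⟩)).symm
    rw [hc, pow_succ] at this
    exact (mul_left_cancel₀ (pow_ne_zero _ hp.ne_zero) this).symm
  have hadj : RankLEOneMod p A'.adjugate :=
    of_mul_eq_det hdet hp.ne_zero (by rw [mul_adjugate, hdet])
  have hdd : diagonal (fun i => if i = i₀ then p else 1) *
      diagonal (fun i => if i = i₀ then 1 else p) = p • (1 : Matrix l l ℤ) := by
    rw [diagonal_mul_diagonal, smul_one_eq_diagonal]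
    congr 1
    ext i
    split_ifs <;> simp
  refine ⟨A'.adjugate * (diagonal (fun i => if i = i₀ then p else 1) * U), ?_,
    hadj.mul_right _⟩
  rw [Matrix.mul_assoc, Matrix.mul_assoc, hUA, ← Matrix.mul_assoc (diagonal _), hdd, Matrix.smul_mul,
    Matrix.one_mul, Matrix.mul_smul, adjugate_mul, hdet, smul_smul, sq]

end RankLEOneMod

/-- Upper-triangular integer matrices with positive diagonal. -/
structure IsPosTriangular {n : ℕ} (C : Matrix (Fin n) (Fin n) ℤ) : Prop where
  lower : ∀ i j, j < i → C i j = 0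
  pos : ∀ i, 0 < C i i

/-- Hermite normal forms of nonsingular integer matrices, for row operations. -/
structure IsHermite {n : ℕ} (C : Matrix (Fin n) (Fin n) ℤ) : Prop extends IsPosTriangular C where
  bound : ∀ i j, i < j → 0 ≤ C i j ∧ C i j < C j j

namespace IsPosTriangular

variable {n : ℕ} {A B C : Matrix (Fin n) (Fin n) ℤ}

theorem det_eq (hC : IsPosTriangular C) : C.det = ∏ i, C i i :=
  det_of_isUpperTriangular fun i j h => hC.lower i j h

theorem det_pos (hC : IsPosTriangular C) : 0 < C.det :=
  hC.det_eq ▸ Finset.prod_pos fun i _ => hC.pos i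

theorem mul_apply_self (hC : IsPosTriangular C) (hB : ∀ i j, j < i → B i j = 0) (i : Fin n) :
    (B * C) i i = B i i * C i i := by
  rw [mul_apply, Finset.sum_eq_single i _ (by simp)]
  intro k _ hk
  rcases lt_or_gt_of_ne hk with h | h
  · simp [hB i k h]
  · simp [hC.lower k i h]

/-- A left factor of an upper-triangular matrix is upper-triangular. -/
theorem lower_of_mul (hC : IsPosTriangular C) (hBC : ∀ i j, j < i → (B * C) i j = 0) :
    ∀ i j, j < i → B i j = 0 := by
  intro i j
  induction j using WellFoundedLT.induction with | _ j ih
  intro hji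
  have h := hBC i j hji
  rw [mul_apply, Finset.sum_eq_single j _ (by simp)] at h
  · exact (mul_eq_zero.1 h).resolve_right (hC.pos j).ne'
  · intro k _ hk
    rcases lt_or_gt_of_ne hk with h | h
    · simp [ih k h (h.trans hji)]
    · simp [hC.lower k j h]

theorem mul (hB : IsPosTriangular B) (hC : IsPosTriangular C) : IsPosTriangular (B * C) where
  lower i j h := by
    rw [mul_apply]
    refine Finset.sum_eq_zero fun k _ => ?_
    rcases lt_or_ge k i with hk | hk
    · simp [hB.lower i k hk]
    · simp [hC.lower k j (h.trans_le hk)]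
  pos i := by
    rw [hC.mul_apply_self hB.lower]
    exact mul_pos (hB.pos i) (hC.pos i)

theorem of_mul (hC : IsPosTriangular C) (hBC : IsPosTriangular (B * C)) : IsPosTriangular B where
  lower := hC.lower_of_mul hBC.lower
  pos i := by
    have := hBC.pos i
    rw [hC.mul_apply_self (hC.lower_of_mul hBC.lower)] at this
    exact pos_of_mul_pos_left this (hC.pos i).le

theorem diag_eq_one (hC : IsPosTriangular C) (h : IsUnit C.det) (i : Fin n) : C i i = 1 := by
  rw [hC.det_eq] at h
  have := isUnit_of_dvd_unit (Finset.dvd_prod_of_mem (fun i => C i i) (Finset.mem_univ i)) h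
  rcases Int.isUnit_iff.1 this with h | h
  · exact h
  · have := hC.pos i
    omega

/-- Row reduction to Hermite form of a triangular matrix with positive diagonal. -/
theorem exists_isHermite (hC : IsPosTriangular C) :
    ∃ G : Matrix (Fin n) (Fin n) ℤ, IsPosTriangular G ∧ (∀ i, G i i = 1) ∧ IsHermite (G * C) := by
  have key : ∀ (i : Fin n) (m : ℕ), m ≤ n → ∃ g : Fin n → ℤ, (∀ k, k < i → g k = 0) ∧ g i = 1 ∧
      ∀ j : Fin n, i < j → j.val < m →
        0 ≤ ∑ k, g k * C k j ∧ ∑ k, g k * C k j < C j j := by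
    intro i m
    induction m with
    | zero => exact fun _ => ⟨Pi.single i 1, fun k hk => by simp [hk.ne], by simp, by simp⟩
    | succ m ih =>
      intro hm
      obtain ⟨g, h0, h1, h2⟩ := ih (by omega)
      by_cases hi : m ≤ i.val
      · refine ⟨g, h0, h1, fun j hj hjm => ?_⟩
        have := Fin.lt_def.1 hj
        omega
      let m' : Fin n := ⟨m, hm⟩
      have him : i < m' := Fin.lt_def.2 (by simpa [m'] using hi)
      let q := (∑ k, g k * C k m') / C m' m'
      have hsum : ∀ j, ∑ k, (g - Pi.single m' q : Fin n → ℤ) k * C k j = ∑ k, g k * C k j - q * C m' j := by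
        intro j
        simp [sub_mul, Finset.sum_sub_distrib, Pi.single_apply]
      refine ⟨g - Pi.single m' q, fun k hk => ?_, ?_, fun j hj hjm => ?_⟩
      · simp [h0 k hk, (hk.trans him).ne]
      · simp [h1, him.ne]
      · rw [hsum]
        rcases eq_or_ne j m' with rfl | hne
        · have hpos := hC.pos m'
          rw [mul_comm, ← Int.emod_def]
          exact ⟨Int.emod_nonneg _ hpos.ne', Int.emod_lt_of_pos _ hpos⟩
        · have hlt : j.val < m := by
            have : j.val ≠ m := fun h => hne (Fin.ext h)
            omega
          rw [hC.lower m' j (Fin.lt_def.2 hlt), mul_zero, sub_zero]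
          exact h2 j hj hlt
  choose g h0 h1 h2 using fun i => key i n le_rfl
  have hG : IsPosTriangular (of g) := ⟨h0, fun i => by simp [h1]⟩
  refine ⟨of g, hG, h1, hG.mul hC, fun i j hij => ?_⟩
  rw [hC.mul_apply_self hG.lower j]
  simpa [mul_apply, h1] using h2 i j hij j.2

end IsPosTriangular

/-- Uniqueness of the Hermite form. -/
theorem IsHermite.eq_of_mul {n : ℕ} {C C' G : Matrix (Fin n) (Fin n) ℤ} (hC : IsHermite C)
    (hC' : IsHermite C') (hG : IsUnit G.det) (h : C' = G * C) : C' = C := by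
  have hGt : IsPosTriangular G := hC.toIsPosTriangular.of_mul (h ▸ hC'.toIsPosTriangular)
  have hG1 := hGt.diag_eq_one hG
  have hdiag : ∀ j, C' j j = C j j := fun j => by
    rw [h, hC.toIsPosTriangular.mul_apply_self hGt.lower, hG1, one_mul]
  have hoff : ∀ i j, i < j → G i j = 0 := by
    intro i j
    induction j using WellFoundedLT.induction with | _ j ih
    intro hij
    have hs : C' i j = C i j + G i j * C j j := by
      rw [h, mul_apply, Finset.sum_eq_add i j hij.ne _ (by simp) (by simp), hG1, one_mul]
      rintro k - ⟨hki, hkj⟩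
      rcases lt_or_gt_of_ne hki with h1 | h1
      · simp [hGt.lower i k h1]
      rcases lt_or_gt_of_ne hkj with h2 | h2
      · simp [ih k h2 h1]
      · simp [hC.lower k j h2]
    obtain ⟨h1, h2⟩ := hC.bound i j hij
    obtain ⟨h3, h4⟩ := hC'.bound i j hij
    rw [hdiag] at h4
    have hp := hC.pos j
    have u1 : G i j < 1 := by by_contra! hc; nlinarith
    have u2 : -1 < G i j := by by_contra! hc; nlinarith
    omega
  have : G = 1 := by
    ext i j
    rcases lt_trichotomy i j with hij | rfl | hij
    · rw [hoff i j hij, one_apply_ne hij.ne]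
    · rw [hG1, one_apply_eq]
    · rw [hGt.lower i j hij, one_apply_ne hij.ne']
  rw [h, this, Matrix.one_mul]

/-- A determinantal divisor divides all minors, with rows and columns listed in any order. -/
theorem detDiv_dvd_det {n k : ℕ} (C : Matrix (Fin n) (Fin n) ℤ) {f g : Fin k → Fin n}
    (hf : f.Injective) (hg : g.Injective) : detDiv n k C ∣ (C.submatrix f g).det := by
  have hs : ∀ {f : Fin k → Fin n}, f.Injective → StrictMono (f ∘ Tuple.sort f) := fun {f} hf =>
    (Tuple.monotone_sort f).strictMono_of_injective (hf.comp (Tuple.sort f).injective)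
  have h : detDiv n k C ∣ (C.submatrix (f ∘ Tuple.sort f) (g ∘ Tuple.sort g)).det :=
    Finset.gcd_dvd (f := fun fg : (Fin k → Fin n) × (Fin k → Fin n) =>
      (C.submatrix fg.1 fg.2).det) (b := (f ∘ Tuple.sort f, g ∘ Tuple.sort g))
      (by simpa using ⟨fun _ _ h => hs hf h, fun _ _ h => hs hg h⟩)
  have e : C.submatrix (f ∘ Tuple.sort f) (g ∘ Tuple.sort g) =
      ((C.submatrix f g).submatrix (Tuple.sort f) id).submatrix id (Tuple.sort g) := rfl
  rw [e, det_permute', det_permute] at h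
  have hu : ∀ σ : Equiv.Perm (Fin k), IsUnit ((Equiv.Perm.sign σ : ℤˣ) : ℤ) := fun σ =>
    Units.isUnit _
  exact (hu _).dvd_mul_left.1 ((hu _).dvd_mul_left.1 h)

theorem dvd_detDiv {n k : ℕ} {C : Matrix (Fin n) (Fin n) ℤ} {d : ℤ}
    (h : ∀ f g : Fin k → Fin n, f.Injective → g.Injective → d ∣ (C.submatrix f g).det) :
    d ∣ detDiv n k C := by
  refine Finset.dvd_gcd fun fg hfg => ?_
  rw [Finset.mem_filter] at hfg
  exact h _ _ (StrictMono.injective fun a b => hfg.2.1 a b)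
    (StrictMono.injective fun a b => hfg.2.2 a b)

theorem detDiv_eq {n k : ℕ} {C : Matrix (Fin n) (Fin n) ℤ} {d : ℤ} (hd : 0 ≤ d)
    (h₁ : detDiv n k C ∣ d) (h₂ : d ∣ detDiv n k C) : detDiv n k C = d := by
  refine Int.dvd_antisymm ?_ hd h₁ h₂
  exact Int.nonneg_of_normalize_eq_self Finset.normalize_gcd

section Representatives

variable {n p : ℕ} {C : Matrix (Fin n) (Fin n) ℤ}

theorem detDiv_eq_pow (hp : p.Prime) (hC : IsHermite C) (hd : ∀ i, C i i = p)
    (hr : RankLEOneMod (p : ℤ) C) (hu : ∃ i j, ¬ (p : ℤ) ∣ C i j) {k : ℕ} (hk : 1 ≤ k)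
    (hkn : k ≤ n - 1) : detDiv n k C = (p : ℤ) ^ (k - 1) := by
  have hp' : Prime (p : ℤ) := Nat.prime_iff_prime_int.1 hp
  refine detDiv_eq (by positivity) ?_ (dvd_detDiv fun f g _ _ => by
    simpa using (hr.submatrix f g).pow_dvd_det hp')
  obtain ⟨a, j, haj⟩ := hu
  have hex : ∃ b, b ≠ a ∧ C a b ≠ 0 := by
    refine ⟨j, ?_, fun h => haj (h ▸ dvd_zero _)⟩
    rintro rfl
    exact haj (by rw [hd])
  obtain ⟨b, ⟨hba, hb⟩, hmin⟩ : ∃ b, (b ≠ a ∧ C a b ≠ 0) ∧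
      ∀ b', (b' ≠ a ∧ C a b' ≠ 0) → ¬ b' < b :=
    ⟨_, WellFounded.min_mem wellFounded_lt {b | b ≠ a ∧ C a b ≠ 0} hex,
      fun b' hb' => WellFounded.not_lt_min wellFounded_lt {b | b ≠ a ∧ C a b ≠ 0} hb'⟩
  have hab : a < b := (lt_or_gt_of_ne hba).resolve_left fun h => hb (hC.lower a b h)
  have hcop : ¬ (p : ℤ) ∣ C a b := by
    obtain ⟨h0, h1⟩ := hC.bound a b hab
    rw [hd] at h1
    exact fun h => hb (Int.eq_zero_of_dvd_of_nonneg_of_lt h0 h1 h)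
  obtain ⟨T, hbT, hTa, hTk⟩ := Finset.exists_subsuperset_card_eq
    (s := {b}) (t := Finset.univ.erase a) (n := k) (by simpa using hba) (by simpa using hk)
    (by simpa using hkn)
  let g : Fin k → Fin n := T.orderEmbOfFin hTk
  have hg : StrictMono g := (T.orderEmbOfFin hTk).strictMono
  have hgT : ∀ i, g i ∈ T := T.orderEmbOfFin_mem hTk
  have hga : ∀ i, g i ≠ a := fun i => Finset.ne_of_mem_erase (hTa (hgT i))
  obtain ⟨i₀, hi₀⟩ : ∃ i, g i = b := by
    have : b ∈ Set.range g := by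
      simpa [g] using hbT
    exact this
  let f : Fin k → Fin n := fun i => if g i = b then a else g i
  have hf : f.Injective := by
    intro x y hxy
    simp only [f] at hxy
    split_ifs at hxy with h1 h2 h2
    · exact hg.injective (h1.trans h2.symm)
    · exact absurd hxy.symm (hga y)
    · exact absurd hxy (hga x)
    · exact hg.injective hxy
  have h1 : detDiv n k C ∣ (p : ℤ) ^ (k - 1) * C a b := by
    have h := detDiv_dvd_det C hf hg.injective
    have hdet : (C.submatrix f g).det = ∏ i, C (f i) (g i) := by
      refine det_of_isUpperTriangular fun i j hji => ?_
      have hlt : g j < g i := hg hji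
      simp only [submatrix_apply, f]
      split_ifs with h
      · by_contra h0
        exact hmin (g j) ⟨hga j, h0⟩ (h ▸ hlt)
      · exact hC.lower _ _ hlt
    rw [hdet, ← Finset.mul_prod_erase _ _ (Finset.mem_univ i₀), Finset.prod_congr rfl
      (g := fun _ => (p : ℤ)), Finset.prod_const, Finset.card_erase_of_mem (Finset.mem_univ _),
      Finset.card_univ, Fintype.card_fin, mul_comm] at h
    · simpa [f, hi₀] using h
    · intro i hi
      have : g i ≠ b := fun h => Finset.ne_of_mem_erase hi (hg.injective (h.trans hi₀.symm))
      simp [f, this, hd]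
  have h2 : detDiv n k C ∣ (p : ℤ) ^ (k - 1) * p := by
    have h := detDiv_dvd_det C hg.injective hg.injective
    have hdet : (C.submatrix g g).det = ∏ i, C (g i) (g i) :=
      det_of_isUpperTriangular fun i j hji => hC.lower _ _ (hg hji)
    rw [hdet, Finset.prod_congr rfl fun i _ => hd (g i), Finset.prod_const, Finset.card_univ,
      Fintype.card_fin] at h
    rwa [← pow_succ, Nat.sub_add_cancel hk]
  obtain ⟨x, y, hxy⟩ := hp'.coprime_iff_not_dvd.2 hcop
  have e : (p : ℤ) ^ (k - 1) = x * ((p : ℤ) ^ (k - 1) * p) + y * ((p : ℤ) ^ (k - 1) * C a b) := by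
    linear_combination (-(p : ℤ) ^ (k - 1)) * hxy
  exact e ▸ dvd_add (h2.mul_left x) (h1.mul_left y)

theorem mem_R0_iff (hp : p.Prime) (hn : 3 ≤ n) :
    C ∈ R0 n p ↔ IsHermite C ∧ (∀ i, C i i = p) ∧ RankLEOneMod (p : ℤ) C ∧
      ∃ i j, ¬ (p : ℤ) ∣ C i j := by
  constructor
  · rintro ⟨hl, hk, -, hd, hb⟩
    have hC : IsHermite C :=
      ⟨⟨hl, fun i => by rw [hd]; exact_mod_cast hp.pos⟩, fun i j h => by rw [hd]; exact hb i j h⟩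
    refine ⟨hC, hd, fun i i' j j' => ?_, ?_⟩
    · by_cases hi : i = i'
      · simp [hi, mul_comm]
      by_cases hj : j = j'
      · simp [hj]
      have h := detDiv_dvd_det C (k := 2) (f := ![i, i']) (g := ![j, j'])
        (by simpa [Function.Injective, Fin.forall_fin_two] using ⟨hi, Ne.symm hi⟩)
        (by simpa [Function.Injective, Fin.forall_fin_two] using ⟨hj, Ne.symm hj⟩)
      rw [hk 2 (by omega) (by omega), det_fin_two] at h
      simpa using h
    · by_contra! h
      have h1 := hk 1 le_rfl (by omega)
      have : (p : ℤ) ∣ detDiv n 1 C := dvd_detDiv fun f g _ _ => by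
        rw [det_fin_one]
        exact h _ _
      rw [h1] at this
      exact (Nat.prime_iff_prime_int.1 hp).not_dvd_one (by simpa using this)
  · rintro ⟨hC, hd, hr, hu⟩
    refine ⟨hC.lower, fun k => detDiv_eq_pow hp hC hd hr hu, ?_, hd,
      fun i j h => hd j ▸ hC.bound i j h⟩
    have hdet : C.det = (p : ℤ) ^ n := by
      simp [hC.toIsPosTriangular.det_eq, hd]
    refine detDiv_eq (by positivity) ?_ (dvd_detDiv fun f g hf hg => ?_)
    · simpa [hdet] using
        detDiv_dvd_det C (Function.injective_id (α := Fin n)) Function.injective_id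
    · let σ := Equiv.ofBijective f (Finite.injective_iff_bijective.1 hf)
      let τ := Equiv.ofBijective g (Finite.injective_iff_bijective.1 hg)
      have e : C.submatrix f g = (C.submatrix σ id).submatrix id τ := rfl
      rw [e, det_permute', det_permute, hdet]
      exact (dvd_mul_left _ _).mul_left _

theorem isHermite_of_mem_R1 (hp : p.Prime) (hC : C ∈ R1 n p) : IsHermite C := by
  obtain ⟨hl, hd, -, -, hb, -⟩ := hC
  refine ⟨⟨hl, fun i => ?_⟩, hb⟩
  have := hp.pos
  rcases hd i with h | h | h <;> rw [h] <;> positivity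

/-- Hermite forms with diagonal as in `R1` are characterized by having rank one modulo `p`. -/
theorem mem_R1_iff (hp : p.Prime) :
    C ∈ R1 n p ↔ IsHermite C ∧ (∀ i, C i i = 1 ∨ C i i = (p : ℤ) ∨ C i i = (p : ℤ) ^ 2) ∧
      (∃! i, C i i = 1) ∧ (∃! i, C i i = (p : ℤ) ^ 2) ∧ RankLEOneMod (p : ℤ) C := by
  have hp1 := (Nat.prime_iff_prime_int.1 hp).not_dvd_one
  constructor
  · intro h
    have hC := isHermite_of_mem_R1 hp h
    obtain ⟨hl, hd, ⟨i₀, hi₀, hi₀'⟩, h2, hb, hdvd⟩ := h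
    refine ⟨hC, hd, ⟨i₀, hi₀, hi₀'⟩, h2, ?_⟩
    have hrow : ∀ i, i ≠ i₀ → ∀ j, (p : ℤ) ∣ C i j := by
      intro i hi j
      have hii : (p : ℤ) ∣ C i i := by
        rcases hd i with h | h | h
        · exact absurd (hi₀' i h) hi
        · rw [h]
        · rw [h]; exact dvd_pow_self _ two_ne_zero
      rcases lt_trichotomy i j with h | rfl | h
      · exact hdvd i j h hii
      · exact hii
      · rw [hl i j h]; exact dvd_zero _
    intro i i' j j'
    by_cases hi : i = i₀
    · by_cases hi' : i' = i₀
      · simp [hi, hi', mul_comm]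
      · exact dvd_sub ((hrow i' hi' _).mul_left _) ((hrow i' hi' _).mul_left _)
    · exact dvd_sub ((hrow i hi _).mul_right _) ((hrow i hi _).mul_right _)
  · rintro ⟨hC, hd, h1, h2, hr⟩
    refine ⟨hC.lower, hd, h1, h2, hC.bound, fun i j hij hi => ?_⟩
    obtain ⟨i₀, hi₀, -⟩ := h1
    have hne : i ≠ i₀ := by
      rintro rfl
      exact hp1 (hi₀ ▸ hi)
    have h0 : C i i₀ = 0 := by
      rcases lt_or_gt_of_ne hne with h | h
      · have := hC.bound i i₀ h
        have hi : C i₀ i₀ = 1 := hi₀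
        omega
      · exact hC.lower i i₀ h
    have := hr i i₀ i₀ j
    simp only [h0, hi₀] at this
    simpa using this

theorem isHermite_of_mem (hp : p.Prime) (hn : 3 ≤ n) (hC : C ∈ R0 n p ∪ R1 n p) :
    IsHermite C :=
  hC.elim (fun h => ((mem_R0_iff hp hn).1 h).1) (isHermite_of_mem_R1 hp)

theorem det_of_mem (hp : p.Prime) (hn : 3 ≤ n) (hC : C ∈ R0 n p ∪ R1 n p) :
    C.det = (p : ℤ) ^ n := by
  rw [(isHermite_of_mem hp hn hC).toIsPosTriangular.det_eq]
  rcases hC with hC | hC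
  · simp [((mem_R0_iff hp hn).1 hC).2.1]
  · obtain ⟨-, hd, ⟨a, ha, ha'⟩, ⟨b, hb, hb'⟩, -⟩ := (mem_R1_iff hp).1 hC
    have hab : b ≠ a := by
      rintro rfl
      have : (p : ℤ) ^ 2 = 1 := hb.symm.trans ha
      have h2 : (2 : ℤ) ≤ p := by exact_mod_cast hp.two_le
      nlinarith
    rw [← Finset.mul_prod_erase _ _ (Finset.mem_univ a), ← Finset.mul_prod_erase _ _
      (Finset.mem_erase.2 ⟨hab, Finset.mem_univ b⟩), Finset.prod_congr rfl (g := fun _ => (p : ℤ))]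
    · rw [show C a a = 1 from ha, show C b b = (p : ℤ) ^ 2 from hb, Finset.prod_const, Finset.card_erase_of_mem (by simp [hab]),
        Finset.card_erase_of_mem (by simp), Finset.card_univ, Fintype.card_fin, one_mul, ← pow_add]
      congr 1
      omega
    · intro i hi
      simp only [Finset.mem_erase, Finset.mem_univ, and_true] at hi
      rcases hd i with h | h | h
      · exact absurd (ha' i h) hi.2
      · exact h
      · exact absurd (hb' i h) hi.1

/-- Every representative is a right factor of `p² • 1`, up to a unimodular matrix, of another
representative. -/
theorem exists_mem_mul_eq (hp : p.Prime) (hn : 3 ≤ n) (hC : C ∈ R0 n p ∪ R1 n p) :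
    ∃ H ∈ R0 n p ∪ R1 n p, ∃ G : Matrix (Fin n) (Fin n) ℤ, G.det = 1 ∧
      H * C = (p : ℤ) ^ 2 • G := by
  have hp' : Prime (p : ℤ) := Nat.prime_iff_prime_int.1 hp
  have hpos : (0 : ℤ) < p := by exact_mod_cast hp.pos
  have hCH := isHermite_of_mem hp hn hC
  have hCt := hCH.toIsPosTriangular
  obtain ⟨hr, i₀, j₀, hu⟩ : RankLEOneMod (p : ℤ) C ∧ ∃ i j, ¬ (p : ℤ) ∣ C i j := by
    rcases hC with hC | hC
    · exact ((mem_R0_iff hp hn).1 hC).2.2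
    · obtain ⟨-, -, ⟨a, ha, -⟩, -, hr⟩ := (mem_R1_iff hp).1 hC
      exact ⟨hr, a, a, fun h => hp'.not_dvd_one (ha ▸ h)⟩
  obtain ⟨B, hBC, hBr⟩ := hr.exists_mul_eq_sq hp' hu (by simpa using det_of_mem hp hn hC)
  have hBCt : IsPosTriangular (B * C) := by
    rw [hBC]
    refine ⟨fun i j h => by simp [h.ne'], fun i => ?_⟩
    simp only [Matrix.smul_apply, one_apply_eq, smul_eq_mul, mul_one]
    positivity
  obtain ⟨G, hG, hG1, hH⟩ := (hCt.of_mul hBCt).exists_isHermite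
  have hGB : G * B * C = (p : ℤ) ^ 2 • G := by
    rw [Matrix.mul_assoc, hBC, Matrix.mul_smul, Matrix.mul_one]
  have hdiag : ∀ i, (G * B) i i * C i i = (p : ℤ) ^ 2 := fun i => by
    rw [← hCt.mul_apply_self hH.lower, hGB, Matrix.smul_apply, hG1, smul_eq_mul, mul_one]
  refine ⟨G * B, ?_, G, by simp [hG.det_eq, hG1], hGB⟩
  rcases hC with hC | hC
  · left
    obtain ⟨-, hd, -⟩ := (mem_R0_iff hp hn).1 hC
    have hHd : ∀ i, (G * B) i i = p := fun i => by
      have := hdiag i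
      rw [hd, sq] at this
      exact mul_right_cancel₀ hp'.ne_zero this
    refine (mem_R0_iff hp hn).2 ⟨hH, hHd, hBr.mul_left G, ?_⟩
    by_contra! hdvd
    have hHp : G * B = (p : ℤ) • (1 : Matrix (Fin n) (Fin n) ℤ) := by
      ext i j
      rcases lt_trichotomy i j with h | rfl | h
      · have hb := hH.bound i j h
        rw [hHd] at hb
        simpa [h.ne] using Int.eq_zero_of_dvd_of_nonneg_of_lt hb.1 hb.2 (hdvd i j)
      · simp [hHd]
      · simpa [h.ne'] using hH.lower i j h
    apply hu
    rw [hHp, Matrix.smul_mul, Matrix.one_mul] at hGB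
    have := congrFun (congrFun hGB i₀) j₀
    simp only [Matrix.smul_apply, smul_eq_mul, sq, mul_assoc] at this
    exact ⟨_, mul_left_cancel₀ hp'.ne_zero this⟩
  · right
    obtain ⟨-, hd, h1, h2, -⟩ := (mem_R1_iff hp).1 hC
    have e1 : ∀ i, (G * B) i i = 1 ↔ C i i = (p : ℤ) ^ 2 := fun i => by
      rw [← hdiag i]
      constructor
      · intro h; rw [h, one_mul]
      · intro h; exact mul_right_cancel₀ (hCt.pos i).ne' (by rw [one_mul]; exact h.symm)
    have e2 : ∀ i, (G * B) i i = (p : ℤ) ^ 2 ↔ C i i = 1 := fun i => by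
      rw [← hdiag i]
      constructor
      · intro h; exact mul_left_cancel₀ (hH.pos i).ne' (by rw [mul_one]; exact h.symm)
      · intro h; rw [h, mul_one]
    refine (mem_R1_iff hp).2 ⟨hH, fun i => ?_, ?_, ?_, hBr.mul_left G⟩
    · rcases hd i with h | h | h
      · exact Or.inr (Or.inr ((e2 i).2 h))
      · refine Or.inr (Or.inl ?_)
        have := hdiag i
        rw [h, sq] at this
        exact mul_right_cancel₀ hp'.ne_zero this
      · exact Or.inl ((e1 i).2 h)
    · simpa only [e1] using h2
    · simpa only [e2] using h1

/-- The left factor with product in the coset of `p² • 1` is unique. -/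
theorem eq_of_mul_eq_smul {H H' G G' : Matrix (Fin n) (Fin n) ℤ} {d : ℤ}
    (hH : IsHermite H) (hH' : IsHermite H') (hC : C.det ≠ 0) (hG : IsUnit G.det)
    (hG' : IsUnit G'.det) (h : H * C = d • G) (h' : H' * C = d • G') : H' = H := by
  refine hH.eq_of_mul hH' (G := G' * G⁻¹) ?_ ?_
  · rw [det_mul]
    exact hG'.mul (isUnit_nonsing_inv_det _ hG)
  · have : H' * C = G' * G⁻¹ * H * C := by
      rw [Matrix.mul_assoc _ H, h, h', Matrix.mul_smul, Matrix.mul_assoc, nonsing_inv_mul _ hG,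
        Matrix.mul_one]
    have h2 := congrArg (· * C.adjugate) this
    simp only [Matrix.mul_assoc, mul_adjugate, Matrix.mul_smul, Matrix.mul_one] at h2
    simpa [Matrix.mul_assoc] using smul_right_injective _ hC h2

theorem toQ_mem_rightCoset_iff {A : Matrix (Fin n) (Fin n) ℤ} :
    toQ n A ∈ rightCoset n ((p : ℚ) ^ 2 • (1 : Matrix (Fin n) (Fin n) ℚ)) ↔
      ∃ G : Matrix (Fin n) (Fin n) ℤ, IsUnit G.det ∧ A = (p : ℤ) ^ 2 • G := by
  have hdet : ∀ G : Matrix (Fin n) (Fin n) ℤ, (toQ n G).det = (G.det : ℚ) := fun G =>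
    (Int.cast_det G).symm
  constructor
  · rintro ⟨γ, ⟨hγ, hγd⟩, h⟩
    choose G hG using hγ
    have hγG : γ = toQ n (of G) := by ext i j; simp [toQ, hG]
    refine ⟨of G, ?_, ?_⟩
    · rw [hγG, hdet] at hγd
      exact Int.isUnit_iff.2 (by exact_mod_cast hγd)
    · ext i j
      have := congrFun (congrFun h i) j
      simp only [toQ, map_apply, Matrix.mul_smul, Matrix.mul_one, Matrix.smul_apply, hG,
        smul_eq_mul] at this
      rw [Matrix.smul_apply, of_apply, smul_eq_mul]
      exact_mod_cast this
  · rintro ⟨G, hG, rfl⟩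
    refine ⟨toQ n G, ⟨fun i j => ⟨G i j, rfl⟩, ?_⟩, ?_⟩
    · rw [hdet]
      exact_mod_cast Int.isUnit_iff.1 hG
    · ext i j
      simp only [toQ, map_apply, Matrix.mul_smul, Matrix.mul_one, Matrix.smul_apply, smul_eq_mul]
      push_cast
      rfl

theorem ncard_pairs_eq (hp : p.Prime) (hn : 3 ≤ n) :
    {CC : Matrix (Fin n) (Fin n) ℤ × Matrix (Fin n) (Fin n) ℤ |
        CC.1 ∈ R0 n p ∪ R1 n p ∧ CC.2 ∈ R0 n p ∪ R1 n p ∧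
        toQ n (CC.1 * CC.2) ∈ rightCoset n ((p : ℚ) ^ 2 • (1 : Matrix (Fin n) (Fin n) ℚ))}.ncard =
      (R0 n p ∪ R1 n p).ncard := by
  rw [← Set.InjOn.ncard_image (f := Prod.snd)]
  · congr 1
    ext C
    constructor
    · rintro ⟨⟨H, C'⟩, ⟨-, h, -⟩, rfl⟩
      exact h
    · intro hC
      obtain ⟨H, hH, G, hG, h⟩ := exists_mem_mul_eq hp hn hC
      exact ⟨(H, C), ⟨hH, hC, toQ_mem_rightCoset_iff.2 ⟨G, hG ▸ isUnit_one, h⟩⟩, rfl⟩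
  · rintro ⟨H, C⟩ ⟨hH, hC, h⟩ ⟨H', C'⟩ ⟨hH', -, h'⟩ (rfl : C = C')
    obtain ⟨G, hG, h⟩ := toQ_mem_rightCoset_iff.1 h
    obtain ⟨G', hG', h'⟩ := toQ_mem_rightCoset_iff.1 h'
    have hp0 : (p : ℤ) ≠ 0 := by exact_mod_cast hp.ne_zero
    exact Prod.ext (eq_of_mul_eq_smul (isHermite_of_mem hp hn hH')
      (isHermite_of_mem hp hn hH)
      (by rw [det_of_mem hp hn hC]; exact pow_ne_zero _ hp0) hG' hG h' h) rfl

end Representatives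

section Counting

variable {n p : ℕ}

/-- The possible entries at `(a, b)` of an element of `R1` whose diagonal entries `1` and `p²` are
at positions `i` and `j`. -/
noncomputable def R1Entry (p : ℕ) (i j a b : Fin n) : Finset ℤ :=
  if a = b then {if a = i then 1 else if a = j then (p : ℤ) ^ 2 else p}
  else if b < a then {0}
  else if a = i then (if b = j then Finset.Ico 0 ((p : ℤ) ^ 2) else Finset.Ico 0 (p : ℤ))
  else if b = j then (Finset.Ico 0 (p : ℤ)).image (fun x => p * x) else {0}

theorem card_R1Entry (hp : p.Prime) (i j a b : Fin n) :
    (R1Entry p i j a b).card =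
      p ^ ((if i = a then (if a < b then 1 else 0) else 0) +
        (if j = b then (if a < b then 1 else 0) else 0)) := by
  have hp0 : (p : ℤ) ≠ 0 := by exact_mod_cast hp.ne_zero
  have h2 : ((p : ℤ) ^ 2).toNat = p ^ 2 := by
    rw [← Nat.cast_pow, Int.toNat_natCast]
  rw [R1Entry]
  rcases lt_trichotomy a b with h | rfl | h
  · rw [if_neg h.ne, if_neg h.not_gt]
    by_cases hi : a = i <;> by_cases hj : b = j
    · simp [hi, hj, hi ▸ hj ▸ h, h2]
    · simp [hi, hj, hi ▸ h, Ne.symm hj]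
    · rw [if_neg hi, if_pos hj, Finset.card_image_of_injective _ (mul_right_injective₀ hp0)]
      simp [hj, hj ▸ h, Ne.symm hi]
    · simp [hi, hj, Ne.symm hi, Ne.symm hj]
  · simp
  · simp [h.ne', h, h.not_gt]

/-- The elements of `R1` whose diagonal entries `1` and `p²` are at positions `i` and `j`. -/
noncomputable def R1Block (p : ℕ) (i j : Fin n) : Finset (Matrix (Fin n) (Fin n) ℤ) :=
  Fintype.piFinset fun a => Fintype.piFinset fun b => R1Entry p i j a b

theorem mem_R1Block {i j : Fin n} {C : Matrix (Fin n) (Fin n) ℤ} :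
    C ∈ R1Block p i j ↔ ∀ a b, C a b ∈ R1Entry p i j a b := by
  simp only [R1Block]
  exact Fintype.mem_piFinset.trans (forall_congr' fun a => Fintype.mem_piFinset)

theorem card_R1Block (hp : p.Prime) (i j : Fin n) :
    (R1Block p i j).card = p ^ (n - 1 - i) * p ^ (j : ℕ) := by
  have h1 : ∑ a : Fin n, ∑ b : Fin n, (if i = a then (if a < b then 1 else 0) else 0) =
      n - 1 - i := by
    have : ∀ a : Fin n, ∑ b : Fin n, (if i = a then (if a < b then 1 else 0) else 0) =
        if i = a then ∑ b : Fin n, (if a < b then 1 else 0) else 0 := fun a => by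
      split_ifs <;> simp
    simp only [this]
    rw [Finset.sum_ite_eq, if_pos (Finset.mem_univ _), Finset.sum_boole, Finset.filter_lt_eq_Ioi,
      Fin.card_Ioi]
    rfl
  have h2 : ∑ a : Fin n, ∑ b : Fin n, (if j = b then (if a < b then 1 else 0) else 0) = j.val := by
    simp only [Finset.sum_ite_eq, Finset.mem_univ, if_true]
    rw [Finset.sum_boole, Finset.filter_gt_eq_Iio, Fin.card_Iio]
    rfl
  have hcard : (R1Block p i j).card = ∏ a, ∏ b, (R1Entry p i j a b).card :=
    (Fintype.card_piFinset _).trans (Finset.prod_congr rfl fun a _ => Fintype.card_piFinset _)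
  rw [hcard]
  simp only [card_R1Entry hp, Finset.prod_pow_eq_pow_sum]
  simp only [Finset.sum_add_distrib]
  rw [h1, h2, pow_add]

theorem diag_of_mem_R1Block (hp : p.Prime) {i j : Fin n} (hij : i ≠ j)
    {C : Matrix (Fin n) (Fin n) ℤ} (hC : C ∈ R1Block p i j) (a : Fin n) :
    (C a a = 1 ∨ C a a = (p : ℤ) ∨ C a a = (p : ℤ) ^ 2) ∧ (C a a = 1 ↔ a = i) ∧
      (C a a = (p : ℤ) ^ 2 ↔ a = j) := by
  have hp2 : (2 : ℤ) ≤ p := by exact_mod_cast hp.two_le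
  have hpp : (p : ℤ) < (p : ℤ) ^ 2 := by nlinarith
  have h := mem_R1Block.1 hC a a
  rw [R1Entry, if_pos rfl, Finset.mem_singleton] at h
  by_cases hi : a = i
  · have hj : a ≠ j := fun h => hij (hi.symm.trans h)
    rw [if_pos hi] at h
    exact ⟨Or.inl h, ⟨fun _ => hi, fun _ => h⟩, ⟨fun h' => by omega, fun h' => absurd h' hj⟩⟩
  · by_cases hj : a = j
    · rw [if_neg hi, if_pos hj] at h
      exact ⟨Or.inr (Or.inr h), ⟨fun h' => by omega, fun h' => absurd h' hi⟩,
        ⟨fun _ => hj, fun _ => h⟩⟩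
    · rw [if_neg hi, if_neg hj] at h
      simp only [h, hi, hj, true_or, or_true, true_and, iff_false]
      omega

theorem mem_R1_iff_exists_block (hp : p.Prime) {C : Matrix (Fin n) (Fin n) ℤ} :
    C ∈ R1 n p ↔ ∃ i j, i ≠ j ∧ C ∈ R1Block p i j := by
  have hp2 : (2 : ℤ) ≤ p := by exact_mod_cast hp.two_le
  have hpp : (p : ℤ) < (p : ℤ) ^ 2 := by nlinarith
  have hp1 := (Nat.prime_iff_prime_int.1 hp).not_dvd_one
  constructor
  · rintro ⟨hl, hd, ⟨i, hi, hi'⟩, ⟨j, hj, hj'⟩, hb, hdvd⟩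
    have hi : C i i = 1 := hi
    have hj : C j j = (p : ℤ) ^ 2 := hj
    have hdvd' : ∀ a b, a < b → a ≠ i → (p : ℤ) ∣ C a b := fun a b hab ha => by
      refine hdvd a b hab ?_
      rcases hd a with h | h | h
      · exact absurd (hi' a h) ha
      · rw [h]
      · rw [h]; exact dvd_pow_self _ two_ne_zero
    have hmid : ∀ a, a ≠ i → a ≠ j → C a a = p := fun a h1 h2 => by
      rcases hd a with h | h | h
      · exact absurd (hi' a h) h1
      · exact h
      · exact absurd (hj' a h) h2
    refine ⟨i, j, ?_, mem_R1Block.2 fun a b => ?_⟩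
    · rintro rfl
      omega
    rw [R1Entry]
    split_ifs with h1 h2 h3 h4 h5 h6 h7
    · subst h1 h2; simpa using hi
    · subst h1 h3; simpa using hj
    · subst h1; simpa using hmid a h2 h3
    · simpa using hl a b h4
    · have := hb a b (by omega)
      rw [h6, hj] at this
      simpa [h6] using this
    · have hab : a < b := by omega
      have := hb a b hab
      rw [hmid b (h5 ▸ hab.ne') h6] at this
      simpa using this
    · have hab : a < b := by omega
      obtain ⟨c, hc⟩ := hdvd' a b hab h5
      have := hb a b hab
      rw [h7, hj, ← h7, hc] at this
      rw [Finset.mem_image]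
      refine ⟨c, Finset.mem_Ico.2 ⟨?_, ?_⟩, hc.symm⟩ <;> nlinarith
    · have hab : a < b := by omega
      obtain ⟨h0, hlt⟩ := hb a b hab
      rw [Finset.mem_singleton]
      by_cases hbi : b = i
      · rw [hbi, hi, ← hbi] at hlt
        omega
      · rw [hmid b hbi ‹_›] at hlt
        exact Int.eq_zero_of_dvd_of_nonneg_of_lt h0 hlt (hdvd' a b hab h5)
  · rintro ⟨i, j, hij, hC⟩
    have hd := diag_of_mem_R1Block hp hij hC
    have hi : C i i = 1 := (hd i).2.1.2 rfl
    have hj : C j j = (p : ℤ) ^ 2 := (hd j).2.2.2 rfl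
    have hle : ∀ b, 0 < C b b := fun b => by
      rcases (hd b).1 with h | h | h <;> rw [h] <;> omega
    have hle' : ∀ b, b ≠ i → (p : ℤ) ≤ C b b := fun b hbi => by
      rcases (hd b).1 with h | h | h
      · exact absurd ((hd b).2.1.1 h) hbi
      · exact h.ge
      · rw [h]; exact hpp.le
    have hC' := mem_R1Block.1 hC
    have hent : ∀ a b, a < b → C a b ∈ (if a = i then (if b = j then Finset.Ico 0 ((p : ℤ) ^ 2)
        else Finset.Ico 0 (p : ℤ)) else if b = j then
          (Finset.Ico 0 (p : ℤ)).image (fun x => p * x) else {0}) := fun a b hab => by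
      have := hC' a b
      rwa [R1Entry, if_neg hab.ne, if_neg hab.not_gt] at this
    refine ⟨fun a b hba => ?_, fun a => (hd a).1, ⟨i, hi, fun a => (hd a).2.1.1⟩,
      ⟨j, hj, fun a => (hd a).2.2.1⟩, fun a b hab => ?_, fun a b hab ha => ?_⟩
    · have := hC' a b
      rw [R1Entry, if_neg hba.ne', if_pos hba] at this
      simpa using this
    · have h := hent a b hab
      split_ifs at h with h1 h2 h2
      · rw [h2, hj, ← h2]
        exact Finset.mem_Ico.1 h
      · have := Finset.mem_Ico.1 h
        exact ⟨this.1, this.2.trans_le (hle' b (h1 ▸ hab.ne'))⟩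
      · obtain ⟨c, hc, hcc⟩ := Finset.mem_image.1 h
        have := Finset.mem_Ico.1 hc
        rw [h2, hj, ← h2, ← hcc]
        constructor <;> nlinarith
      · rw [Finset.mem_singleton.1 h]
        exact ⟨le_rfl, hle b⟩
    · have hai : a ≠ i := by
        rintro rfl
        exact hp1 (hi ▸ ha)
      have h := hent a b hab
      rw [if_neg hai] at h
      split_ifs at h with h2
      · obtain ⟨c, hc, hcc⟩ := Finset.mem_image.1 h
        exact ⟨c, hcc.symm⟩
      · rw [Finset.mem_singleton.1 h]
        exact dvd_zero _

theorem ncard_R1 (hp : p.Prime) : (R1 n p).Finite ∧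
    (R1 n p).ncard = ∑ x : Fin n, ∑ y ∈ Finset.univ.erase x, p ^ (n - 1 - x) * p ^ (y : ℕ) := by
  have h : R1 n p = ↑(((Finset.univ : Finset (Fin n)).sigma fun x =>
      Finset.univ.erase x).biUnion fun x => R1Block p x.1 x.2) := by
    ext C
    simp [mem_R1_iff_exists_block hp, Sigma.exists, eq_comm]
  rw [h]
  refine ⟨Finset.finite_toSet _, ?_⟩
  rw [Set.ncard_coe_finset, Finset.card_biUnion]
  · simp only [card_R1Block hp]
    rw [Finset.sum_sigma]
  · rintro ⟨i, j⟩ hx ⟨i', j'⟩ hy hne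
    refine Finset.disjoint_left.2 fun C hC hC' => ?_
    have hx : i ≠ j := (Finset.ne_of_mem_erase (Finset.mem_sigma.1 hx).2).symm
    have hy : i' ≠ j' := (Finset.ne_of_mem_erase (Finset.mem_sigma.1 hy).2).symm
    have hi := (diag_of_mem_R1Block hp hy hC' i).2.1.1 ((diag_of_mem_R1Block hp hx hC i).2.1.2 rfl)
    have hj := (diag_of_mem_R1Block hp hy hC' j).2.2.1 ((diag_of_mem_R1Block hp hx hC j).2.2.2 rfl)
    exact hne (Sigma.ext hi (heq_of_eq hj))

/-- Normalized factorizations of the strictly upper-triangular rank one matrices over `ZMod p`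
with first nonzero column `b`. -/
def R0Factors (p : ℕ) [NeZero p] (b : Fin n) : Finset ((Fin n → ZMod p) × (Fin n → ZMod p)) :=
  ((Fintype.piFinset fun i => if i < b then Finset.univ else {0}).erase 0) ×ˢ
    (Fintype.piFinset fun j => if j < b then {0} else if j = b then {1} else Finset.univ)

theorem mem_R0Factors [NeZero p] {b : Fin n} {u v : Fin n → ZMod p} :
    (u, v) ∈ R0Factors p b ↔
      (u ≠ 0 ∧ ∀ i, b ≤ i → u i = 0) ∧ (∀ j, j < b → v j = 0) ∧ v b = 1 := by
  simp only [R0Factors, Finset.mem_product, Finset.mem_erase, Fintype.mem_piFinset]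
  refine and_congr (and_congr Iff.rfl (forall_congr' fun i => ?_)) ⟨fun h => ⟨fun j hj => ?_, ?_⟩,
    fun h j => ?_⟩
  · split_ifs with h
    · simp [h]
    · simp [not_lt.1 h]
  · simpa [hj] using h j
  · simpa using h b
  · split_ifs with h1 h2
    · simpa using h.1 j h1
    · simpa [h2] using h.2
    · simp

theorem card_R0Factors [NeZero p] (b : Fin n) :
    (R0Factors p b).card = (p ^ (b : ℕ) - 1) * p ^ (n - 1 - b) := by
  rw [R0Factors, Finset.card_product, Finset.card_erase_of_mem, Fintype.card_piFinset,
    Fintype.card_piFinset]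
  · congr 1
    · have : ∀ i : Fin n, (if i < b then (Finset.univ : Finset (ZMod p)) else {0}).card =
          if i < b then p else 1 := fun i => by split_ifs <;> simp [ZMod.card]
      simp only [this]
      rw [Finset.prod_ite, Finset.prod_const, Finset.prod_const_one, mul_one,
        Finset.filter_gt_eq_Iio, Fin.card_Iio]
    · have : ∀ j : Fin n, (if j < b then ({0} : Finset (ZMod p)) else if j = b then {1}
          else Finset.univ).card = if b < j then p else 1 := fun j => by
        rcases lt_trichotomy j b with h | rfl | h
        · simp [h, h.not_gt]
        · simp
        · simp [h, h.not_gt, h.ne', ZMod.card]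
      simp only [this]
      rw [Finset.prod_ite, Finset.prod_const, Finset.prod_const_one, mul_one,
        Finset.filter_lt_eq_Ioi, Fin.card_Ioi]
  · rw [Fintype.mem_piFinset]
    intro i
    split_ifs <;> simp

/-- The element of `R0` with given reduction `u vᵀ` modulo `p`. -/
def R0OfFactors (u v : Fin n → ZMod p) : Matrix (Fin n) (Fin n) ℤ :=
  of fun i j => if i = j then (p : ℤ) else ((u i * v j).val : ℤ)

theorem cast_R0OfFactors [NeZero p] {b : Fin n} {u v : Fin n → ZMod p}
    (h : (u, v) ∈ R0Factors p b) (i j : Fin n) :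
    ((R0OfFactors u v i j : ℤ) : ZMod p) = u i * v j := by
  obtain ⟨⟨-, hu⟩, hv, -⟩ := mem_R0Factors.1 h
  rw [R0OfFactors, of_apply]
  split_ifs with hij
  · subst hij
    rcases lt_or_ge i b with h | h
    · simp [hv i h]
    · simp [hu i h]
  · simp

theorem R0OfFactors_mem (hp : p.Prime) (hn : 3 ≤ n) [NeZero p] {b : Fin n} {u v : Fin n → ZMod p}
    (h : (u, v) ∈ R0Factors p b) : R0OfFactors u v ∈ R0 n p := by
  have hc := cast_R0OfFactors h
  obtain ⟨⟨hu0, hu⟩, hv, hvb⟩ := mem_R0Factors.1 h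
  have hd : ∀ i, R0OfFactors u v i i = p := fun i => by simp [R0OfFactors]
  refine (mem_R0_iff hp hn).2 ⟨⟨⟨fun i j hji => ?_, fun i => ?_⟩, fun i j hij => ?_⟩, hd,
    fun i i' j j' => ?_, ?_⟩
  · rw [R0OfFactors, of_apply, if_neg hji.ne']
    rcases lt_or_ge j b with h | h
    · simp [hv j h]
    · simp [hu i (h.trans hji.le)]
  · rw [hd]
    exact_mod_cast hp.pos
  · rw [hd, R0OfFactors, of_apply, if_neg hij.ne]
    exact ⟨by positivity, by exact_mod_cast ZMod.val_lt _⟩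
  · rw [← ZMod.intCast_zmod_eq_zero_iff_dvd]
    push_cast
    rw [hc, hc, hc, hc]
    ring
  · obtain ⟨i, hi⟩ := Function.ne_iff.1 hu0
    refine ⟨i, b, ?_⟩
    rw [← ZMod.intCast_zmod_eq_zero_iff_dvd, hc, hvb, mul_one]
    exact hi

theorem exists_factors (hp : p.Prime) (hn : 3 ≤ n) [NeZero p] {C : Matrix (Fin n) (Fin n) ℤ}
    (hC : C ∈ R0 n p) : ∃ b u v, (u, v) ∈ R0Factors p b ∧ R0OfFactors u v = C := by
  have := Fact.mk hp
  obtain ⟨hH, hd, hr, i, j, hij⟩ := (mem_R0_iff hp hn).1 hC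
  let N : Matrix (Fin n) (Fin n) (ZMod p) := C.map (fun z : ℤ => (z : ZMod p))
  have hN : ∀ i i' j j', N i j * N i' j' = N i j' * N i' j := fun i i' j j' => by
    have := (ZMod.intCast_zmod_eq_zero_iff_dvd _ _).2 (hr i i' j j')
    push_cast at this
    exact sub_eq_zero.1 this
  have hlow : ∀ i j, j ≤ i → N i j = 0 := fun i j hji => by
    rcases hji.lt_or_eq with h | rfl
    · simp [N, hH.lower i j h]
    · simp [N, hd]
  have hex : ∃ b i, N i b ≠ 0 :=
    ⟨j, i, fun h => hij ((ZMod.intCast_zmod_eq_zero_iff_dvd _ _).1 h)⟩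
  obtain ⟨b, ⟨i₁, hb⟩, hmin⟩ : ∃ b, (∃ i, N i b ≠ 0) ∧ ∀ b', (∃ i, N i b' ≠ 0) → ¬ b' < b :=
    ⟨_, WellFounded.min_mem wellFounded_lt {b | ∃ i, N i b ≠ 0} hex,
      fun b' hb' => WellFounded.not_lt_min wellFounded_lt {b | ∃ i, N i b ≠ 0} hb'⟩
  have hfac : (fun i => N i b, fun j => N i₁ j / N i₁ b) ∈ R0Factors p b := by
    refine mem_R0Factors.2 ⟨⟨fun h => hb (congrFun h i₁), fun i hi => hlow i b hi⟩,
      fun j hj => ?_, div_self hb⟩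
    have : N i₁ j = 0 := by
      by_contra h
      exact hmin j ⟨i₁, h⟩ hj
    simp [this]
  refine ⟨b, _, _, hfac, ?_⟩
  ext i j
  have hval : N i b * (N i₁ j / N i₁ b) = N i j := by
    rw [← mul_div_assoc, hN i i₁ b j, mul_div_cancel_right₀ _ hb]
  simp only [R0OfFactors, of_apply, hval]
  rcases lt_trichotomy i j with h | rfl | h
  · rw [if_neg h.ne]
    have hb := hH.bound i j h
    rw [hd] at hb
    simp only [N, map_apply]
    rw [ZMod.val_intCast, Int.emod_eq_of_lt hb.1 hb.2]
  · rw [if_pos rfl, hd]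
  · rw [if_neg h.ne', hlow i j h.le, hH.lower i j h, ZMod.val_zero, Nat.cast_zero]

theorem R0Factors_injective (hp : p.Prime) [NeZero p] {b b' : Fin n} {u v u' v' : Fin n → ZMod p}
    (h : (u, v) ∈ R0Factors p b) (h' : (u', v') ∈ R0Factors p b')
    (heq : R0OfFactors u v = R0OfFactors u' v') : b = b' ∧ u = u' ∧ v = v' := by
  have := Fact.mk hp
  have key : ∀ i j, u i * v j = u' i * v' j := fun i j => by
    rw [← cast_R0OfFactors h, ← cast_R0OfFactors h', heq]
  obtain ⟨⟨hu0, -⟩, hv, hvb⟩ := mem_R0Factors.1 h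
  obtain ⟨⟨hu0', -⟩, hv', hvb'⟩ := mem_R0Factors.1 h'
  have hbb : b = b' := by
    rcases lt_trichotomy b b' with hlt | heq | hlt
    · refine absurd (funext fun i => ?_) hu0
      simpa [hvb, hv' b hlt] using key i b
    · exact heq
    · refine absurd (funext fun i => ?_) hu0'
      simpa [hvb', hv b' hlt] using (key i b').symm
  subst hbb
  have hu : u = u' := funext fun i => by simpa [hvb, hvb'] using key i b
  subst hu
  obtain ⟨i, hi⟩ := Function.ne_iff.1 hu0
  exact ⟨rfl, rfl, funext fun j => mul_left_cancel₀ hi (key i j)⟩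

theorem ncard_R0 (hp : p.Prime) (hn : 3 ≤ n) : (R0 n p).Finite ∧
    (R0 n p).ncard = ∑ b : Fin n, (p ^ (b : ℕ) - 1) * p ^ (n - 1 - b) := by
  have : NeZero p := ⟨hp.ne_zero⟩
  have h : R0 n p = (fun x : Σ _ : Fin n, (Fin n → ZMod p) × (Fin n → ZMod p) =>
      R0OfFactors x.2.1 x.2.2) '' ↑((Finset.univ : Finset (Fin n)).sigma (R0Factors p)) := by
    ext C
    constructor
    · intro hC
      obtain ⟨b, u, v, h, rfl⟩ := exists_factors hp hn hC
      exact ⟨⟨b, u, v⟩, by simpa using h, rfl⟩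
    · rintro ⟨⟨b, u, v⟩, h, rfl⟩
      exact R0OfFactors_mem hp hn (b := b) (by simpa using h)
  rw [h]
  refine ⟨(Finset.finite_toSet _).image _, ?_⟩
  rw [Set.InjOn.ncard_image, Set.ncard_coe_finset, Finset.card_sigma]
  · simp only [card_R0Factors]
  · rintro ⟨b, u, v⟩ hx ⟨b', u', v'⟩ hy heq
    obtain ⟨rfl, rfl, rfl⟩ := R0Factors_injective hp (by simpa using hx) (by simpa using hy) heq
    rfl

theorem disjoint_R0_R1 (hp : p.Prime) : Disjoint (R0 n p) (R1 n p) := by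
  rw [Set.disjoint_left]
  rintro C ⟨-, -, -, hd, -⟩ ⟨-, -, ⟨i, hi, -⟩, -⟩
  have : (p : ℤ) = 1 := (hd i).symm.trans hi
  exact hp.ne_one (by exact_mod_cast this)

theorem ncard_R (hp : p.Prime) (hn : 3 ≤ n) : ((R0 n p ∪ R1 n p).ncard : ℚ) =
    (p : ℚ) * ((p : ℚ) ^ (n - 1) - 1) * ((p : ℚ) ^ n - 1) / ((p : ℚ) - 1) ^ 2 := by
  obtain ⟨f0, h0⟩ := ncard_R0 hp hn
  obtain ⟨f1, h1⟩ := ncard_R1 (n := n) hp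
  rw [Set.ncard_union_eq (disjoint_R0_R1 hp) f0 f1, h0, h1]
  have hp1 : (p : ℚ) ≠ 1 := by exact_mod_cast hp.ne_one
  have hmul : ∀ b : Fin n, (p : ℚ) ^ (b : ℕ) * (p : ℚ) ^ (n - 1 - b) = (p : ℚ) ^ (n - 1) :=
    fun b => by rw [← pow_add]; congr 1; omega
  have hG : ∑ b : Fin n, (p : ℚ) ^ (b : ℕ) = ((p : ℚ) ^ n - 1) / (p - 1) := by
    rw [← geom_sum_eq hp1, ← Fin.sum_univ_eq_sum_range (fun i => (p : ℚ) ^ i)]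
  have hG' : ∑ b : Fin n, (p : ℚ) ^ (n - 1 - b) = ((p : ℚ) ^ n - 1) / (p - 1) := by
    rw [← geom_sum_eq hp1, ← Finset.sum_range_reflect,
      ← Fin.sum_univ_eq_sum_range (fun i => (p : ℚ) ^ (n - 1 - i))]
  have e0 : ((∑ b : Fin n, (p ^ (b : ℕ) - 1) * p ^ (n - 1 - b) : ℕ) : ℚ) =
      n * (p : ℚ) ^ (n - 1) - ((p : ℚ) ^ n - 1) / (p - 1) := by
    push_cast [Nat.cast_sub (Nat.one_le_pow _ _ hp.pos)]
    simp only [sub_mul, one_mul, hmul, Finset.sum_sub_distrib, hG']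
    simp
  have e1 : ((∑ x : Fin n, ∑ y ∈ Finset.univ.erase x, p ^ (n - 1 - x) * p ^ (y : ℕ) : ℕ) : ℚ) =
      (((p : ℚ) ^ n - 1) / (p - 1)) ^ 2 - n * (p : ℚ) ^ (n - 1) := by
    push_cast
    simp only [Finset.sum_erase_eq_sub (Finset.mem_univ _), ← Finset.mul_sum, hG,
      Finset.sum_sub_distrib, ← Finset.sum_mul, hG']
    simp only [mul_comm ((p : ℚ) ^ (n - 1 - _)), hmul]
    simp [sq]
  rw [Nat.cast_add, e0, e1]
  have hn' : (p : ℚ) ^ n = p * (p : ℚ) ^ (n - 1) := by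
    rw [← pow_succ', Nat.sub_add_cancel (by omega)]
  have : (p : ℚ) - 1 ≠ 0 := sub_ne_zero.2 hp1
  rw [hn']
  field_simp
  ring

end Counting

theorem statement14 (n p : ℕ) (hn : 4 ≤ n) (hp : p.Prime) :
    ({CC : Matrix (Fin n) (Fin n) ℤ × Matrix (Fin n) (Fin n) ℤ |
        CC.1 ∈ R0 n p ∪ R1 n p ∧ CC.2 ∈ R0 n p ∪ R1 n p ∧
        toQ n (CC.1 * CC.2) ∈ rightCoset n ((p : ℚ) ^ 2 • (1 : Matrix (Fin n) (Fin n) ℚ))}.ncard : ℚ) =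
      (p : ℚ) * ((p : ℚ) ^ (n - 1) - 1) * ((p : ℚ) ^ n - 1) / ((p : ℚ) - 1) ^ 2 := by
  rw [ncard_pairs_eq hp (by omega), ncard_R hp (by omega)]
end
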